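/- Let n ≥ 4 be an integer. Define ℰ_n = {(r,s,t) ∈ {1,…,n−1}³ : r+s+t ≡ 0 (mod n)} and Ē_n = {(a,b,c) ∈ {1,…,⌊n/2⌋}³ : a+b+c = n, or a+b = c, or a+c = b, or b+c = a}, and define π : ℰ_n → {1,…,⌊n/2⌋}³ by π(r,s,t) = (min(r, n−r), min(s, n−s), min(t, n−t)). Then the image of π is exactly Ē_n, and for every (a,b,c) ∈ Ē_n the fiber π^{−1}(a,b,c) contains exactly 2 elements of ℰ_n. -/

import Mathlib

/-- `ℰ_n = {(r,s,t) ∈ {1,…,n−1}³ : r+s+t ≡ 0 (mod n)}`. -/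
def calE (n : ℕ) : Set (ℕ × ℕ × ℕ) :=
  {p | (1 ≤ p.1 ∧ p.1 ≤ n - 1) ∧ (1 ≤ p.2.1 ∧ p.2.1 ≤ n - 1) ∧ (1 ≤ p.2.2 ∧ p.2.2 ≤ n - 1) ∧
    (p.1 + p.2.1 + p.2.2) % n = 0}

/-- `Ē_n = {(a,b,c) ∈ {1,…,⌊n/2⌋}³ : a+b+c = n, or a+b = c, or a+c = b, or b+c = a}`. -/
def calEbar (n : ℕ) : Set (ℕ × ℕ × ℕ) :=
  {p | (1 ≤ p.1 ∧ p.1 ≤ n / 2) ∧ (1 ≤ p.2.1 ∧ p.2.1 ≤ n / 2) ∧ (1 ≤ p.2.2 ∧ p.2.2 ≤ n / 2) ∧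
    (p.1 + p.2.1 + p.2.2 = n ∨ p.1 + p.2.1 = p.2.2 ∨ p.1 + p.2.2 = p.2.1 ∨
      p.2.1 + p.2.2 = p.1)}

/-- `π(r,s,t) = (min(r, n−r), min(s, n−s), min(t, n−t))`. -/
def piMap (n : ℕ) (p : ℕ × ℕ × ℕ) : ℕ × ℕ × ℕ :=
  (min p.1 (n - p.1), min p.2.1 (n - p.2.1), min p.2.2 (n - p.2.2))

theorem calE_iff (n : ℕ) (hn : 4 ≤ n) (r s t : ℕ) : (r, s, t) ∈ calE n ↔
    (1 ≤ r ∧ r ≤ n - 1) ∧ (1 ≤ s ∧ s ≤ n - 1) ∧ (1 ≤ t ∧ t ≤ n - 1) ∧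
      (r + s + t = n ∨ r + s + t = 2 * n) := by
  simp only [calE, Set.mem_setOf_eq]
  constructor
  · rintro ⟨h1, h2, h3, h4⟩
    refine ⟨h1, h2, h3, ?_⟩
    obtain ⟨k, hk⟩ := Nat.dvd_of_mod_eq_zero h4
    have hk3 : k < 3 := by
      by_contra h
      have : n * 3 ≤ n * k := Nat.mul_le_mul_left n (by omega)
      omega
    interval_cases k <;> omega
  · rintro ⟨h1, h2, h3, h4 | h4⟩
    · exact ⟨h1, h2, h3, by rw [h4]; simp⟩
    · exact ⟨h1, h2, h3, by rw [h4]; simp⟩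

/-- The fiber over a point of `Ē_n` is an explicit pair. -/
theorem fiber_pair (n : ℕ) (hn : 4 ≤ n) (p : ℕ × ℕ × ℕ) (hp : p ∈ calEbar n) :
    ∃ x y, x ≠ y ∧ {q ∈ calE n | piMap n q = p} = {x, y} := by
  obtain ⟨a, b, c⟩ := p
  obtain ⟨h1, h2, h3, h⟩ := hp
  dsimp only at h1 h2 h3 h
  rcases h with h | h | h | h
  · refine ⟨(a, b, c), (n - a, n - b, n - c), ?_, ?_⟩
    · simp only [ne_eq, Prod.mk.injEq]; omega
    · ext ⟨r, s, t⟩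
      simp only [Set.mem_setOf_eq, calE_iff n hn, piMap, Set.mem_insert_iff,
        Set.mem_singleton_iff, Prod.mk.injEq]
      omega
  · refine ⟨(a, b, n - c), (n - a, n - b, c), ?_, ?_⟩
    · simp only [ne_eq, Prod.mk.injEq]; omega
    · ext ⟨r, s, t⟩
      simp only [Set.mem_setOf_eq, calE_iff n hn, piMap, Set.mem_insert_iff,
        Set.mem_singleton_iff, Prod.mk.injEq]
      omega
  · refine ⟨(a, n - b, c), (n - a, b, n - c), ?_, ?_⟩
    · simp only [ne_eq, Prod.mk.injEq]; omega
    · ext ⟨r, s, t⟩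
      simp only [Set.mem_setOf_eq, calE_iff n hn, piMap, Set.mem_insert_iff,
        Set.mem_singleton_iff, Prod.mk.injEq]
      omega
  · refine ⟨(n - a, b, c), (a, n - b, n - c), ?_, ?_⟩
    · simp only [ne_eq, Prod.mk.injEq]; omega
    · ext ⟨r, s, t⟩
      simp only [Set.mem_setOf_eq, calE_iff n hn, piMap, Set.mem_insert_iff,
        Set.mem_singleton_iff, Prod.mk.injEq]
      omega

/-- For `n ≥ 4`: the image of `ℰ_n` under `π` is exactly `Ē_n`, and `π` is two-to-one,
i.e. every fiber over a point of `Ē_n` contains exactly `2` elements of `ℰ_n`. -/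
theorem piMap_image_and_two_to_one (n : ℕ) (hn : 4 ≤ n) :
    piMap n '' calE n = calEbar n ∧
      ∀ p ∈ calEbar n, Set.ncard {q ∈ calE n | piMap n q = p} = 2 := by
  refine ⟨?_, ?_⟩
  · ext p
    constructor
    · rintro ⟨⟨r, s, t⟩, hq, rfl⟩
      rw [calE_iff n hn] at hq
      simp only [calEbar, piMap, Set.mem_setOf_eq]
      omega
    · intro hp
      obtain ⟨x, y, -, h⟩ := fiber_pair n hn p hp
      have hx : x ∈ {q ∈ calE n | piMap n q = p} := by rw [h]; simp
      exact ⟨x, hx.1, hx.2⟩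
  · intro p hp
    obtain ⟨x, y, hxy, h⟩ := fiber_pair n hn p hp
    rw [h]
    exact Set.ncard_pair hxy
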